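/- For every λ > 0 and f ∈ L¹(ℍ): (i) I_λ f(z,t) is finite for almost every (z,t), and ∫_{ℂ×[0,π/λ²)} |I_λ f(z,t)| · λ dz dt ≤ 2π ‖f‖_{L¹(ℍ)}; (ii) if moreover f is continuous with compact support, then I_λ f(z,t) = I^red_λ(P_λ f)(z,t) for every (z,t). (Boundedness and factorization of I_λ through central periodization.) -/

import Mathlib

noncomputable section

open Complex MeasureTheory Real Set ENNReal NNReal

/-- Heisenberg group multiplication on ℂ × ℝ. -/
def hmul (p q : ℂ × ℝ) : ℂ × ℝ :=
  (p.1 + q.1, p.2 + q.2 + (p.1.re * q.1.im - p.1.im * q.1.re) / 2)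

/-- The model sub-Riemannian geodesic of charge `lam`:
`γ_λ(s) = (R e^{i s / R}, s R / 2)` with `R = 1/λ`. -/
def geo (lam : ℝ) (s : ℝ) : ℂ × ℝ :=
  (((lam : ℂ))⁻¹ * Complex.exp (Complex.I * ((lam * s : ℝ) : ℂ)), s / (2 * lam))

/-- The sub-Riemannian X-ray transform `I_λ f (z,t) = ∫ f((z,t)·γ_λ(s)) ds`. -/
def xray (lam : ℝ) (f : ℂ × ℝ → ℂ) (p : ℂ × ℝ) : ℂ :=
  ∫ s : ℝ, f (hmul p (geo lam s))

lemma lintegral_eq_tsum_Ico {L : ℝ} (hL : 0 < L) (h : ℝ → ℝ≥0∞) :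
    ∫⁻ s, h s = ∑' k : ℤ, ∫⁻ s in Ico 0 L, h (s + k * L) := by
  rw [← setLIntegral_univ, ← iUnion_Ico_add_zsmul hL 0,
    lintegral_iUnion (fun _ => measurableSet_Ico) (pairwise_disjoint_Ico_add_zsmul 0 L)]
  congr 1 with k
  rw [← (measurePreserving_add_right volume ((k : ℝ) * L)).setLIntegral_comp_preimage_emb
    (measurableEmbedding_addRight _)]
  congr 3
  ext s
  simp [add_mul, add_comm]

lemma integral_eq_tsum_Ico {L : ℝ} (hL : 0 < L) {F : ℝ → ℂ} (hF : Integrable F) :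
    ∫ s, F s = ∑' k : ℤ, ∫ s in Ico 0 L, F (s + k * L) := by
  rw [← setIntegral_univ, ← iUnion_Ico_add_zsmul hL 0,
    integral_iUnion (fun _ => measurableSet_Ico) (pairwise_disjoint_Ico_add_zsmul 0 L)
      hF.integrableOn]
  congr 1 with k
  rw [← (measurePreserving_add_right volume ((k : ℝ) * L)).setIntegral_preimage_emb
    (measurableEmbedding_addRight _)]
  congr 3
  ext s
  simp [add_mul, add_comm]

lemma integral_eq_integral_tsum {L : ℝ} (hL : 0 < L) {F : ℝ → ℂ} (hF : Integrable F) :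
    ∫ s, F s = ∫ s in (0 : ℝ)..L, ∑' k : ℤ, F (s + k * L) := by
  rw [integral_eq_tsum_Ico hL hF, intervalIntegral.integral_of_le hL.le,
    ← integral_Ico_eq_integral_Ioc, integral_tsum]
  · intro k
    exact (hF.1.comp_measurePreserving (measurePreserving_add_right volume _)).restrict
  · rw [← lintegral_eq_tsum_Ico hL (fun s => ‖F s‖ₑ)]
    exact hF.2.ne

lemma lintegral_heisenberg_eq_tsum {T : ℝ} (hT : 0 < T) (a : ℝ) (g : ℂ × ℝ → ℝ≥0∞) :
    ∫⁻ p, g p = ∑' k : ℤ, ∫⁻ p in univ ×ˢ Ico a (a + T), g (p.1, p.2 + k * T) := by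
  have hU : (⋃ k : ℤ, (univ : Set ℂ) ×ˢ Ico (a + k • T) (a + (k + 1) • T)) = univ := by
    rw [← prod_iUnion, iUnion_Ico_add_zsmul hT a, univ_prod_univ]
  rw [← setLIntegral_univ, ← hU,
    lintegral_iUnion (fun _ => MeasurableSet.univ.prod measurableSet_Ico)
      fun i j hij => disjoint_prod.2 (.inr (pairwise_disjoint_Ico_add_zsmul a T hij))]
  congr 1 with k
  have hk : MeasurePreserving fun p : ℂ × ℝ => (p.1, p.2 + k * T) :=
    (MeasurePreserving.id volume).prod (measurePreserving_add_right volume _)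
  have hke : MeasurableEmbedding fun p : ℂ × ℝ => (p.1, p.2 + k * T) :=
    MeasurableEmbedding.id.prodMap (measurableEmbedding_addRight _)
  have hD : (fun p : ℂ × ℝ => (p.1, p.2 + k * T)) ⁻¹'
      (univ ×ˢ Ico (a + k • T) (a + (k + 1) • T)) = univ ×ˢ Ico a (a + T) := by
    ext p
    simp only [mem_prod, mem_univ, true_and, mem_preimage, mem_Ico, zsmul_eq_mul]
    push_cast
    constructor <;> rintro ⟨h, h'⟩ <;> constructor <;> linarith
  rw [← hk.setLIntegral_comp_preimage_emb hke, hD]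

lemma continuous_hmul : Continuous fun x : (ℂ × ℝ) × (ℂ × ℝ) => hmul x.1 x.2 := by
  unfold hmul
  fun_prop

lemma continuous_geo (lam : ℝ) : Continuous (geo lam) := by
  unfold geo
  fun_prop

lemma measurePreserving_hmul_right (q : ℂ × ℝ) : MeasurePreserving (fun p => hmul p q) := by
  refine MeasurePreserving.skew_product (f := fun z : ℂ => z + q.1)
    (g := fun z t => t + q.2 + (z.re * q.1.im - z.im * q.1.re) / 2)
    (measurePreserving_add_right volume q.1) (by fun_prop) ?_
  filter_upwards with z
  simp only [add_assoc]
  exact (measurePreserving_add_right volume _).map_eq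

lemma quasiMeasurePreserving_hmul_geo (lam : ℝ) :
    Measure.QuasiMeasurePreserving (fun x : (ℂ × ℝ) × ℝ => hmul x.1 (geo lam x.2)) := by
  have h : MeasurePreserving (fun x : ℝ × (ℂ × ℝ) => (x.1, hmul x.2 (geo lam x.1))) :=
    MeasurePreserving.skew_product (g := fun s p => hmul p (geo lam s)) (MeasurePreserving.id volume)
      (continuous_hmul.comp (continuous_snd.prodMk
        ((continuous_geo lam).comp continuous_fst))).measurable
      (.of_forall fun s => (measurePreserving_hmul_right _).map_eq)
  exact (Measure.quasiMeasurePreserving_snd.comp h.quasiMeasurePreserving).comp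
    Measure.measurePreserving_swap.quasiMeasurePreserving

lemma geo_add_period {lam : ℝ} (hlam : lam ≠ 0) (s : ℝ) (k : ℤ) :
    geo lam (s + k * (2 * π / lam)) = ((geo lam s).1, (geo lam s).2 + k * (π / lam ^ 2)) := by
  have h : Complex.exp (Complex.I * ((lam * (s + k * (2 * π / lam)) : ℝ) : ℂ)) =
      Complex.exp (Complex.I * ((lam * s : ℝ) : ℂ)) := by
    rw [← Complex.exp_periodic.int_mul k (Complex.I * ((lam * s : ℝ) : ℂ))]
    congr 1
    have : lam * (s + k * (2 * π / lam)) = lam * s + k * (2 * π) := by field_simp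
    rw [this]
    push_cast
    ring
  unfold geo
  rw [h]
  congr 1
  field_simp

lemma hmul_geo_add_period {lam : ℝ} (hlam : lam ≠ 0) (p : ℂ × ℝ) (s : ℝ) (k : ℤ) :
    hmul p (geo lam (s + k * (2 * π / lam))) =
      ((hmul p (geo lam s)).1, (hmul p (geo lam s)).2 + k * (π / lam ^ 2)) := by
  rw [geo_add_period hlam]
  simp only [hmul, Prod.mk.injEq, true_and]
  ring

lemma hmul_add_center (p q : ℂ × ℝ) (t : ℝ) :
    hmul (p.1, p.2 + t) q = ((hmul p q).1, (hmul p q).2 + t) := by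
  simp only [hmul, Prod.mk.injEq, true_and]
  ring

lemma lintegral_lintegral_hmul_geo {lam : ℝ} (hlam : 0 < lam) (a : ℝ) {g : ℂ × ℝ → ℝ≥0∞}
    (hg : AEMeasurable g) :
    ∫⁻ p in univ ×ˢ Ico a (a + π / lam ^ 2), ∫⁻ s, g (hmul p (geo lam s)) =
      ENNReal.ofReal (2 * π / lam) * ∫⁻ p, g p := by
  have hL : 0 < 2 * π / lam := by positivity
  have hT : 0 < π / lam ^ 2 := by positivity
  have hG : AEMeasurable (fun x : (ℂ × ℝ) × ℝ => g (hmul x.1 (geo lam x.2)))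
      ((volume.restrict (univ ×ˢ Ico a (a + π / lam ^ 2))).prod volume) :=
    (hg.comp_quasiMeasurePreserving (quasiMeasurePreserving_hmul_geo lam)).mono_ac
      (Measure.AbsolutelyContinuous.prod Measure.absolutelyContinuous_restrict .rfl)
  have hh : AEMeasurable fun s => ∫⁻ p in univ ×ˢ Ico a (a + π / lam ^ 2),
      g (hmul p (geo lam s)) := hG.lintegral_prod_left'
  rw [lintegral_lintegral_swap hG, lintegral_eq_tsum_Ico hL, ← lintegral_tsum]
  · have key (s : ℝ) : ∑' k : ℤ, ∫⁻ p in univ ×ˢ Ico a (a + π / lam ^ 2),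
        g (hmul p (geo lam (s + k * (2 * π / lam)))) = ∫⁻ p, g p := by
      have hs := measurePreserving_hmul_right (geo lam s)
      simp only [hmul_geo_add_period hlam.ne', ← hmul_add_center]
      rw [← lintegral_heisenberg_eq_tsum hT a fun p => g (hmul p (geo lam s)),
        ← lintegral_map' (hs.map_eq.symm ▸ hg) hs.measurable.aemeasurable, hs.map_eq]
    simp only [key]
    simp [mul_comm]
  · intro k
    exact (hh.comp_quasiMeasurePreserving
      (measurePreserving_add_right volume _).quasiMeasurePreserving).restrict

lemma integrable_prod_hmul_geo {lam : ℝ} (hlam : 0 < lam) (a : ℝ) {f : ℂ × ℝ → ℂ}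
    (hf : Integrable f) :
    Integrable (fun x : (ℂ × ℝ) × ℝ => f (hmul x.1 (geo lam x.2)))
      ((volume.restrict (univ ×ˢ Ico a (a + π / lam ^ 2))).prod volume) := by
  have hm : AEStronglyMeasurable (fun x : (ℂ × ℝ) × ℝ => f (hmul x.1 (geo lam x.2)))
      ((volume.restrict (univ ×ˢ Ico a (a + π / lam ^ 2))).prod volume) :=
    (hf.1.comp_quasiMeasurePreserving (quasiMeasurePreserving_hmul_geo lam)).mono_ac
      (Measure.AbsolutelyContinuous.prod Measure.absolutelyContinuous_restrict .rfl)
  refine ⟨hm, ?_⟩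
  rw [hasFiniteIntegral_iff_enorm, lintegral_prod _ hm.enorm,
    lintegral_lintegral_hmul_geo hlam a hf.1.enorm]
  exact ENNReal.mul_lt_top ENNReal.ofReal_lt_top hf.2

lemma ae_integrable_hmul_geo {lam : ℝ} (hlam : 0 < lam) {f : ℂ × ℝ → ℂ} (hf : Integrable f) :
    ∀ᵐ p : ℂ × ℝ, Integrable fun s : ℝ => f (hmul p (geo lam s)) := by
  have hT : 0 < π / lam ^ 2 := by positivity
  have hU : (⋃ k : ℤ, (univ : Set ℂ) ×ˢ Ico (0 + k • (π / lam ^ 2)) (0 + (k + 1) • (π / lam ^ 2)))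
      = univ := by
    rw [← prod_iUnion, iUnion_Ico_add_zsmul hT 0, univ_prod_univ]
  rw [← Measure.restrict_univ (μ := (volume : Measure (ℂ × ℝ))), ← hU, ae_restrict_iUnion_iff]
  intro k
  rw [add_smul, one_smul, ← add_assoc]
  exact (integrable_prod_hmul_geo hlam _ hf).prod_right_ae

lemma lintegral_enorm_xray_le {lam : ℝ} (hlam : 0 < lam) {f : ℂ × ℝ → ℂ}
    (hf : AEStronglyMeasurable f) (a : ℝ) :
    ∫⁻ p in univ ×ˢ Ico a (a + π / lam ^ 2), ‖xray lam f p‖ₑ * ENNReal.ofReal lam ≤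
      ENNReal.ofReal (2 * π) * ∫⁻ p, ‖f p‖ₑ := by
  rw [lintegral_mul_const' _ _ ENNReal.ofReal_ne_top]
  calc _ ≤ (∫⁻ p in univ ×ˢ Ico a (a + π / lam ^ 2), ∫⁻ s, ‖f (hmul p (geo lam s))‖ₑ) *
        ENNReal.ofReal lam := by
        gcongr
        exact enorm_integral_le_lintegral_enorm _
    _ = ENNReal.ofReal (2 * π) * ∫⁻ p, ‖f p‖ₑ := by
        rw [lintegral_lintegral_hmul_geo hlam a hf.enorm, mul_right_comm,
          ← ENNReal.ofReal_mul (by positivity), div_mul_cancel₀ _ hlam.ne']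

lemma HasCompactSupport.comp_hmul_geo {lam : ℝ} (hlam : lam ≠ 0) {f : ℂ × ℝ → ℂ}
    (hf : HasCompactSupport f) (p : ℂ × ℝ) :
    HasCompactSupport fun s => f (hmul p (geo lam s)) := by
  have hφ : Continuous fun q => 2 * lam * (hmul (-p) q).2 := by
    unfold hmul
    fun_prop
  refine HasCompactSupport.intro (hf.isCompact.image hφ) fun s hs => ?_
  by_contra h
  refine hs ⟨_, subset_tsupport f h, ?_⟩
  simp only [hmul, geo, Prod.fst_neg, Prod.snd_neg, Complex.neg_re, Complex.neg_im,
    Complex.add_re, Complex.add_im]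
  field_simp
  ring

/-- **Boundedness and factorization of `I_λ` through central periodization.**
(i) For `f ∈ L¹(ℍ)` the integral defining `I_λ f` converges a.e., and
`∫_{ℂ×[0,π/λ²)} |I_λ f| λ dz dt ≤ 2π ‖f‖₁`;
(ii) if `f` is continuous with compact support then `I_λ f = I^red_λ (P_λ f)` pointwise. -/
theorem xray_bounded_factors (lam : ℝ) (hlam : 0 < lam)
    (f : ℂ × ℝ → ℂ) (hf : Integrable f) :
    (∀ᵐ p : ℂ × ℝ, Integrable (fun s : ℝ => f (hmul p (geo lam s)))) ∧
    (∫⁻ p in (Set.univ : Set ℂ) ×ˢ Set.Ico (0 : ℝ) (π / lam ^ 2),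
        (‖xray lam f p‖₊ : ℝ≥0∞) * ENNReal.ofReal lam
      ≤ ENNReal.ofReal (2 * π) * ∫⁻ p : ℂ × ℝ, (‖f p‖₊ : ℝ≥0∞)) ∧
    (Continuous f → HasCompactSupport f → ∀ p : ℂ × ℝ,
      xray lam f p
        = ∫ s in (0 : ℝ)..(2 * π / lam),
            (fun q : ℂ × ℝ => ∑' k : ℤ, f (q.1, q.2 + (k : ℝ) * (π / lam ^ 2)))
              (hmul p (geo lam s))) := by
  refine ⟨ae_integrable_hmul_geo hlam hf, ?_, fun hc hs p => ?_⟩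
  · simpa only [zero_add, enorm_eq_nnnorm] using lintegral_enorm_xray_le hlam hf.1 0
  · have hF : Integrable fun s => f (hmul p (geo lam s)) :=
      (hc.comp (continuous_hmul.comp
        (continuous_const.prodMk (continuous_geo lam)))).integrable_of_hasCompactSupport
        (hs.comp_hmul_geo hlam.ne' p)
    simp only [xray, integral_eq_integral_tsum (by positivity : 0 < 2 * π / lam) hF,
      hmul_geo_add_period hlam.ne']

end
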